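/- arXiv:2202.06185 — 2 statements merged into one kernel-verified Lean document; each statement's English description precedes it below -/
import Mathlib

section
/- Given N ∈ ℕ, there exists a constant C = C(N) < ∞ such that the following holds. Let (V, ⟨·,·⟩) be a real inner product space of dimension at most N, and let J be a complex structure on V compatible with the inner product. If v_1, …, v_{2k+1} ∈ V are orthonormal, then there exist real numbers (a_{ij}) and (b_{ij}), for 1 ≤ i ≤ 2k+2 and 1 ≤ j ≤ 2k+1, with |a_{ij}| + |b_{ij}| ≤ C for all i, j, such that the vectors ṽ_i := Σ_{j=1}^{2k+1} (a_{ij} v_j + b_{ij} J v_j), 1 ≤ i ≤ 2k+2, are orthonormal. -/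
open scoped RealInnerProductSpace

section

variable {V : Type*} [NormedAddCommGroup V] [InnerProductSpace ℝ V]

/-- The residual of `x` after orthogonal projection to the span of an orthonormal family `u`
is orthogonal to `u`. -/
lemma Orthonormal.inner_sub_sum_eq_zero {ι : Type*} [Fintype ι] {u : ι → V}
    (hu : Orthonormal ℝ u) (x : V) (i : ι) :
    ⟪u i, x - ∑ l, ⟪u l, x⟫ • u l⟫ = 0 := by
  rw [inner_sub_right, hu.inner_right_fintype, sub_self]

lemma Orthonormal.norm_sub_sum_sq {ι : Type*} [Fintype ι] {u : ι → V}
    (hu : Orthonormal ℝ u) (x : V) :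
    ‖x - ∑ l, ⟪u l, x⟫ • u l‖ ^ 2 = ‖x‖ ^ 2 - ∑ l, ⟪u l, x⟫ ^ 2 := by
  rw [← real_inner_self_eq_norm_sq, inner_sub_left, sum_inner]
  simp_rw [real_inner_smul_left, hu.inner_sub_sum_eq_zero, mul_zero]
  rw [Finset.sum_const_zero, sub_zero, inner_sub_right, inner_sum, real_inner_self_eq_norm_sq]
  simp_rw [real_inner_smul_right, real_inner_comm _ x, sq]

/-- If `v` is a larger orthonormal family than `u`, some member of `v` is at distance at least
`1 / √(card κ)` from the span of `u`. -/
lemma Orthonormal.exists_one_le_card_mul_norm_sub_sum_sq {ι κ : Type*} [Fintype ι] [Fintype κ]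
    {u : ι → V} {v : κ → V} (hu : Orthonormal ℝ u) (hv : Orthonormal ℝ v)
    (hcard : Fintype.card ι < Fintype.card κ) :
    ∃ j, 1 ≤ (Fintype.card κ : ℝ) * ‖v j - ∑ l, ⟪u l, v j⟫ • u l‖ ^ 2 := by
  by_contra! h
  have hne : (Finset.univ : Finset κ).Nonempty :=
    Finset.card_pos.mp (by rw [Finset.card_univ]; omega)
  have hlt := Finset.sum_lt_sum_of_nonempty hne fun j _ => h j
  rw [← Finset.mul_sum] at hlt
  simp_rw [hu.norm_sub_sum_sq, hv.1] at hlt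
  rw [Finset.sum_sub_distrib, Finset.sum_comm] at hlt
  have hbessel : ∑ l, ∑ j, ⟪u l, v j⟫ ^ 2 ≤ ∑ _l : ι, (1 : ℝ) := by
    refine Finset.sum_le_sum fun l _ => ?_
    simpa [hu.1 l, real_inner_comm] using
      hv.sum_inner_products_le (x := u l) (s := Finset.univ)
  simp only [Finset.sum_const, Finset.card_univ, nsmul_eq_mul, mul_one, one_pow] at hlt hbessel
  have hcard' : (Fintype.card ι : ℝ) + 1 ≤ Fintype.card κ := by exact_mod_cast hcard
  nlinarith [Nat.cast_nonneg (α := ℝ) (Fintype.card ι)]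

/-- `x` is a combination of the vectors `v j` and `J (v j)` with coefficients bounded by `C`. -/
def IsBoundedCombination {κ : Type*} [Fintype κ] (J : V →ₗ[ℝ] V) (v : κ → V) (C : ℝ) (x : V) :
    Prop :=
  ∃ a b : κ → ℝ, (∀ j, |a j| + |b j| ≤ C) ∧ x = ∑ j, (a j • v j + b j • J (v j))

namespace IsBoundedCombination

variable {κ : Type*} [Fintype κ] {J : V →ₗ[ℝ] V} {v : κ → V} {C D : ℝ} {x y : V}

lemma mono (h : IsBoundedCombination J v C x) (hCD : C ≤ D) : IsBoundedCombination J v D x := by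
  obtain ⟨a, b, hab, rfl⟩ := h
  exact ⟨a, b, fun j => (hab j).trans hCD, rfl⟩

lemma zero : IsBoundedCombination J v 0 0 :=
  ⟨0, 0, by simp, by simp⟩

lemma apply (j : κ) : IsBoundedCombination J v 1 (v j) := by
  classical
  refine ⟨Pi.single j 1, 0, fun l => ?_, ?_⟩
  · by_cases h : l = j <;> simp [h]
  · simp [Pi.single_apply]

lemma add (hx : IsBoundedCombination J v C x) (hy : IsBoundedCombination J v D y) :
    IsBoundedCombination J v (C + D) (x + y) := by
  obtain ⟨a, b, hab, rfl⟩ := hx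
  obtain ⟨c, d, hcd, rfl⟩ := hy
  refine ⟨a + c, b + d, fun j => ?_, ?_⟩
  · simp only [Pi.add_apply]
    linarith [abs_add_le (a j) (c j), abs_add_le (b j) (d j), hab j, hcd j]
  · rw [← Finset.sum_add_distrib]
    refine Finset.sum_congr rfl fun j _ => ?_
    simp only [Pi.add_apply]
    module

lemma smul (hx : IsBoundedCombination J v C x) (r : ℝ) :
    IsBoundedCombination J v (|r| * C) (r • x) := by
  obtain ⟨a, b, hab, rfl⟩ := hx
  refine ⟨r • a, r • b, fun j => ?_, ?_⟩
  · simp only [Pi.smul_apply, smul_eq_mul, abs_mul, ← mul_add]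
    exact mul_le_mul_of_nonneg_left (hab j) (abs_nonneg r)
  · simp [Finset.smul_sum, smul_smul]

lemma sub (hx : IsBoundedCombination J v C x) (hy : IsBoundedCombination J v D y) :
    IsBoundedCombination J v (C + D) (x - y) := by
  simpa [sub_eq_add_neg] using hx.add (hy.smul (-1))

lemma sum {ι : Type*} {s : Finset ι} {f : ι → V}
    (hf : ∀ i ∈ s, IsBoundedCombination J v C (f i)) :
    IsBoundedCombination J v (s.card * C) (∑ i ∈ s, f i) := by
  classical
  induction s using Finset.induction_on with
  | empty => simpa using zero
  | insert i s hi ih =>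
    rw [Finset.sum_insert hi]
    refine ((hf i (by simp)).add (ih fun l hl => hf l (by simp [hl]))).mono ?_
    rw [Finset.card_insert_of_notMem hi]
    push_cast
    linarith

lemma map (hJ : ∀ v, J (J v) = -v) (hx : IsBoundedCombination J v C x) :
    IsBoundedCombination J v C (J x) := by
  obtain ⟨a, b, hab, rfl⟩ := hx
  refine ⟨-b, a, fun j => ?_, ?_⟩
  · simpa [add_comm] using hab j
  · simp [hJ, add_comm]

end IsBoundedCombination

lemma inner_map_left_of_complexStructure {J : V →ₗ[ℝ] V} (hJ : ∀ v, J (J v) = -v)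
    (hJi : ∀ v w : V, ⟪J v, J w⟫ = ⟪v, w⟫) (x y : V) : ⟪J x, y⟫ = -⟪x, J y⟫ := by
  rw [← hJi x (J y), hJ, inner_neg_right, neg_neg]

/-- A unit vector `z` orthogonal to the complex span of `w` extends the unitary family `w`. -/
lemma Orthonormal.sumElim_cons {J : V →ₗ[ℝ] V} (hJ : ∀ v, J (J v) = -v)
    (hJi : ∀ v w : V, ⟪J v, J w⟫ = ⟪v, w⟫) {m : ℕ} {w : Fin m → V}
    (hw : Orthonormal ℝ (Sum.elim w (J ∘ w))) {z : V} (hz : ‖z‖ = 1)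
    (hwz : ∀ i, ⟪w i, z⟫ = 0) (hJwz : ∀ i, ⟪J (w i), z⟫ = 0) :
    Orthonormal ℝ (Sum.elim (Fin.cons z w : Fin (m + 1) → V)
      (J ∘ (Fin.cons z w : Fin (m + 1) → V))) := by
  have hskew := inner_map_left_of_complexStructure hJ hJi
  have hwJz : ∀ i, ⟪w i, J z⟫ = 0 := fun i => by
    have := hskew (w i) z
    rw [hJwz] at this
    linarith
  have hzw : ∀ i, ⟪z, w i⟫ = 0 := fun i => by rw [real_inner_comm, hwz]
  have hzJw : ∀ i, ⟪z, J (w i)⟫ = 0 := fun i => by rw [real_inner_comm, hJwz]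
  have hzJz : ⟪z, J z⟫ = 0 := by
    have := hskew z z
    rw [real_inner_comm] at this
    linarith
  rw [orthonormal_iff_ite] at hw
  have hww : ∀ i j, ⟪w i, w j⟫ = if i = j then 1 else 0 := fun i j => by
    simpa using hw (.inl i) (.inl j)
  have hwJw : ∀ i j, ⟪w i, J (w j)⟫ = 0 := fun i j => by
    simpa using hw (.inl i) (.inr j)
  have h₁ : ∀ i j, ⟪(Fin.cons z w : Fin (m + 1) → V) i, (Fin.cons z w : Fin (m + 1) → V) j⟫ =
      if i = j then (1 : ℝ) else 0 := by
    intro i j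
    cases i using Fin.cases <;> cases j using Fin.cases <;>
      simp [hwz, hzw, hww, Fin.succ_ne_zero, (Fin.succ_ne_zero _).symm, hz]
  have h₂ : ∀ i j, ⟪(Fin.cons z w : Fin (m + 1) → V) i,
      J ((Fin.cons z w : Fin (m + 1) → V) j)⟫ = 0 := by
    intro i j
    cases i using Fin.cases <;> cases j using Fin.cases <;>
      simp [hzJz, hwJz, hzJw, hwJw]
  rw [orthonormal_iff_ite]
  rintro (i | i) (j | j) <;> simp [h₁, h₂, hJi, hskew]

/-- Recursive coefficient bound for pivoted complex Gram–Schmidt on at most `N` vectors. -/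
noncomputable def gramSchmidtBound (N : ℕ) : ℕ → ℝ
  | 0 => 0
  | m + 1 => gramSchmidtBound N m + N * (1 + 2 * m * gramSchmidtBound N m)

lemma gramSchmidtBound_nonneg (N m : ℕ) : 0 ≤ gramSchmidtBound N m := by
  induction m with
  | zero => exact le_rfl
  | succ m ih => rw [gramSchmidtBound]; positivity

lemma gramSchmidtBound_monotone (N : ℕ) : Monotone (gramSchmidtBound N) := by
  refine monotone_nat_of_le_succ fun m => ?_
  have := gramSchmidtBound_nonneg N m
  rw [gramSchmidtBound]
  exact le_add_of_nonneg_right (by positivity)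

/-- Pivoted complex Gram–Schmidt: from `card κ` real-orthonormal vectors one extracts `m` unitary
vectors with controlled coefficients whenever `2 m ≤ card κ + 1`. -/
lemma exists_orthonormal_isBoundedCombination {κ : Type*} [Fintype κ] {J : V →ₗ[ℝ] V}
    (hJ : ∀ v, J (J v) = -v) (hJi : ∀ v w : V, ⟪J v, J w⟫ = ⟪v, w⟫) {v : κ → V}
    (hv : Orthonormal ℝ v) {N : ℕ} (hN : Fintype.card κ ≤ N) (m : ℕ)
    (hm : 2 * m ≤ Fintype.card κ + 1) :
    ∃ w : Fin m → V, Orthonormal ℝ (Sum.elim w (J ∘ w)) ∧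
      ∀ i, IsBoundedCombination J v (gramSchmidtBound N m) (w i) := by
  induction m with
  | zero =>
    exact ⟨Fin.elim0, ⟨fun i => isEmptyElim i, fun i => isEmptyElim i⟩, fun i => i.elim0⟩
  | succ m ih =>
    obtain ⟨w, hw, hwb⟩ := ih (by omega)
    obtain ⟨j, hj⟩ := hw.exists_one_le_card_mul_norm_sub_sum_sq hv
      (by simp only [Fintype.card_sum, Fintype.card_fin]; omega)
    have horth := hw.inner_sub_sum_eq_zero (v j)
    have hxb : IsBoundedCombination J v (1 + 2 * m * gramSchmidtBound N m)
        (v j - ∑ l, ⟪Sum.elim w (J ∘ w) l, v j⟫ • Sum.elim w (J ∘ w) l) := by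
      refine ((IsBoundedCombination.apply j).sub (IsBoundedCombination.sum
        (C := gramSchmidtBound N m) fun l _ => ?_)).mono (le_of_eq ?_)
      · have hl : IsBoundedCombination J v (gramSchmidtBound N m) (Sum.elim w (J ∘ w) l) := by
          rcases l with i | i
          · exact hwb i
          · exact (hwb i).map hJ
        refine (hl.smul _).mono (mul_le_of_le_one_left (gramSchmidtBound_nonneg N m) ?_)
        simpa [hw.1 l, hv.1 j] using abs_real_inner_le_norm (Sum.elim w (J ∘ w) l) (v j)
      · simp only [Finset.card_univ, Fintype.card_sum, Fintype.card_fin]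
        push_cast
        ring
    set x := v j - ∑ l, ⟪Sum.elim w (J ∘ w) l, v j⟫ • Sum.elim w (J ∘ w) l
    have hN' : (Fintype.card κ : ℝ) ≤ N := by exact_mod_cast hN
    have hNx : 1 ≤ (N : ℝ) * ‖x‖ ^ 2 := hj.trans (by gcongr)
    have hx0 : 0 < ‖x‖ := by
      refine (norm_nonneg x).lt_of_ne fun h => ?_
      rw [← h] at hNx
      norm_num at hNx
    have hN1 : (1 : ℝ) ≤ N := by
      have : N ≠ 0 := by rintro rfl; norm_num at hNx
      exact_mod_cast Nat.one_le_iff_ne_zero.mpr this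
    have hinv : |‖x‖⁻¹| ≤ N := by
      rw [abs_of_pos (inv_pos.mpr hx0), inv_le_iff_one_le_mul₀ hx0]
      by_contra! h
      nlinarith
    have hC := gramSchmidtBound_nonneg N m
    refine ⟨Fin.cons (‖x‖⁻¹ • x) w, hw.sumElim_cons hJ hJi ?_ (fun i => ?_) (fun i => ?_),
      fun i => ?_⟩
    · rw [norm_smul, norm_inv, norm_norm, inv_mul_cancel₀ hx0.ne']
    · rw [real_inner_smul_right, show ⟪w i, x⟫ = 0 from horth (.inl i), mul_zero]
    · rw [real_inner_smul_right, show ⟪J (w i), x⟫ = 0 from horth (.inr i), mul_zero]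
    · cases i using Fin.cases with
      | zero =>
        rw [Fin.cons_zero]
        refine (hxb.smul _).mono ?_
        rw [gramSchmidtBound]
        exact (mul_le_mul_of_nonneg_right hinv (by positivity)).trans
          (le_add_of_nonneg_left hC)
      | succ i =>
        rw [Fin.cons_succ]
        exact (hwb i).mono (gramSchmidtBound_monotone N m.le_succ)

end

/-- Given `N`, there is a constant `C = C(N)` such that: if `V` is a real inner product space
of dimension at most `N`, `J` is a complex structure on `V` compatible with the inner product,
and `v₁, …, v_{2k+1} ∈ V` are orthonormal, then there exist coefficients `a_{ij}, b_{ij}` with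
`|a_{ij}| + |b_{ij}| ≤ C` such that the vectors
`ṽᵢ = Σⱼ (a_{ij} vⱼ + b_{ij} J vⱼ)`, `1 ≤ i ≤ 2k+2`, are orthonormal. -/
theorem exists_orthonormal_extension_complex_structure (N : ℕ) :
    ∃ C : ℝ, ∀ (V : Type) [NormedAddCommGroup V] [InnerProductSpace ℝ V]
      [FiniteDimensional ℝ V], Module.finrank ℝ V ≤ N →
      ∀ (J : V →ₗ[ℝ] V), (∀ v, J (J v) = -v) →
      (∀ v w : V, ⟪J v, J w⟫ = ⟪v, w⟫) →
      ∀ (k : ℕ) (v : Fin (2 * k + 1) → V), Orthonormal ℝ v →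
      ∃ a b : Fin (2 * k + 2) → Fin (2 * k + 1) → ℝ,
        (∀ i j, |a i j| + |b i j| ≤ C) ∧
        Orthonormal ℝ (fun i => ∑ j, (a i j • v j + b i j • J (v j))) := by
  refine ⟨gramSchmidtBound N (N + 1), ?_⟩
  intro V _ _ _ hdim J hJ hJi k v hv
  have hk : 2 * k + 1 ≤ N := by
    simpa using hv.linearIndependent.fintype_card_le_finrank.trans hdim
  obtain ⟨w, hw, hwb⟩ := exists_orthonormal_isBoundedCombination hJ hJi hv
    (N := N) (by simpa using hk) (k + 1) (by simp only [Fintype.card_fin]; omega)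
  let e : Fin (2 * k + 2) ≃ Fin (k + 1) ⊕ Fin (k + 1) :=
    (finCongr (by omega)).trans finSumFinEquiv.symm
  have hb : ∀ i, IsBoundedCombination J v (gramSchmidtBound N (N + 1))
      (Sum.elim w (J ∘ w) (e i)) := by
    intro i
    refine IsBoundedCombination.mono ?_ (gramSchmidtBound_monotone N (by omega : k + 1 ≤ N + 1))
    rcases e i with l | l
    · exact hwb l
    · exact (hwb l).map hJ
  choose a b hab heq using hb
  refine ⟨a, b, hab, ?_⟩
  simp_rw [← heq]
  exact hw.comp e e.injective
end

section
/- Given N ∈ ℕ, there exists a constant c = c(N) > 0 such that the following holds. Let (V, ⟨·,·⟩) be a real inner product space of dimension at most N, and let J be a complex structure on V compatible with the inner product. Then for any orthonormal vectors v_1, …, v_{2k+1} ∈ V, there exists an index i ∈ {1, …, 2k+1} such that the vector w_i := J v_i − Σ_{j=1}^{2k+1} ⟨J v_i, v_j⟩ v_j satisfies ‖w_i‖ ≥ c. -/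
open scoped RealInnerProductSpace

/-- A skew-symmetric real matrix of odd size is singular. -/
theorem Matrix.det_eq_zero_of_transpose_eq_neg_of_odd {n : Type*} [Fintype n] [DecidableEq n]
    (hn : Odd (Fintype.card n)) (A : Matrix n n ℝ) (hA : A.transpose = -A) : A.det = 0 := by
  have h : A.det = -A.det := by
    calc A.det = A.transpose.det := A.det_transpose.symm
      _ = -A.det := by rw [hA, Matrix.det_neg, hn.neg_one_pow, neg_one_mul]
  linarith

/-- A compatible complex structure is skew-adjoint. -/
theorem inner_complexStructure_left {V : Type*} [NormedAddCommGroup V] [InnerProductSpace ℝ V]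
    {J : V →ₗ[ℝ] V} (hJ : ∀ v, J (J v) = -v) (hJi : ∀ v w : V, ⟪J v, J w⟫ = ⟪v, w⟫) (x y : V) :
    ⟪J x, y⟫ = -⟪J y, x⟫ := by
  rw [← hJi (J x) y, hJ, inner_neg_left, real_inner_comm]

/-- The span of an odd number of orthonormal vectors contains a nonzero vector whose image under
a compatible complex structure is orthogonal to that span. -/
theorem exists_ne_zero_complexStructure_orthogonal {V : Type*} [NormedAddCommGroup V]
    [InnerProductSpace ℝ V] {J : V →ₗ[ℝ] V} (hJ : ∀ v, J (J v) = -v)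
    (hJi : ∀ v w : V, ⟪J v, J w⟫ = ⟪v, w⟫) {n : Type*} [Fintype n]
    (hn : Odd (Fintype.card n)) {v : n → V} (hv : Orthonormal ℝ v) :
    ∃ a : n → ℝ, ∑ i, a i • v i ≠ 0 ∧ ∀ j, ∑ i, a i * ⟪J (v i), v j⟫ = 0 := by
  classical
  let A : Matrix n n ℝ := Matrix.of fun i j => ⟪J (v i), v j⟫
  have hA : A.transpose = -A := by
    ext i j
    exact inner_complexStructure_left hJ hJi (v j) (v i)
  obtain ⟨a, ha, haA⟩ := Matrix.exists_vecMul_eq_zero_iff.mpr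
    (Matrix.det_eq_zero_of_transpose_eq_neg_of_odd hn A hA)
  refine ⟨a, fun h => ha ?_, fun j => congrFun haA j⟩
  exact funext (Fintype.linearIndependent_iff.mp hv.linearIndependent a h)

/-- Given `N`, there is a constant `c = c(N) > 0` such that: if `V` is a real inner product
space of dimension at most `N`, `J` is a complex structure on `V` compatible with the inner
product, and `v₁, …, v_{2k+1} ∈ V` are orthonormal, then there is an index `i` such that
`wᵢ := J vᵢ − Σⱼ ⟪J vᵢ, vⱼ⟫ vⱼ` satisfies `‖wᵢ‖ ≥ c`. -/
theorem exists_large_orthogonal_component_complex_structure (N : ℕ) :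
    ∃ c : ℝ, 0 < c ∧ ∀ (V : Type) [NormedAddCommGroup V] [InnerProductSpace ℝ V]
      [FiniteDimensional ℝ V], Module.finrank ℝ V ≤ N →
      ∀ (J : V →ₗ[ℝ] V), (∀ v, J (J v) = -v) →
      (∀ v w : V, ⟪J v, J w⟫ = ⟪v, w⟫) →
      ∀ (k : ℕ) (v : Fin (2 * k + 1) → V), Orthonormal ℝ v →
      ∃ i : Fin (2 * k + 1), c ≤ ‖J (v i) - ∑ j, ⟪J (v i), v j⟫ • v j‖ := by
  refine ⟨1 / ((N : ℝ) + 1), by positivity, ?_⟩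
  intro V _ _ _ hN J hJ hJi k v hv
  obtain ⟨a, hu, ha⟩ := exists_ne_zero_complexStructure_orthogonal hJ hJi
    (by simp : Odd (Fintype.card (Fin (2 * k + 1)))) hv
  by_contra! hw
  set u := ∑ i, a i • v i with hu_def
  have hcard : ((2 * k + 1 : ℕ) : ℝ) ≤ N := by
    have h := hv.linearIndependent.fintype_card_le_finrank
    rw [Fintype.card_fin] at h
    exact_mod_cast h.trans hN
  have hcoef : ∀ i, |a i| ≤ ‖u‖ := fun i => by
    have h := abs_real_inner_le_norm (v i) u
    rwa [hu_def, hv.inner_right_fintype, hv.1 i, one_mul] at h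
  have hJu : J u = ∑ i, a i • (J (v i) - ∑ j, ⟪J (v i), v j⟫ • v j) := by
    simp only [smul_sub, Finset.sum_sub_distrib, Finset.smul_sum, smul_smul]
    rw [Finset.sum_comm (f := fun i j => (a i * ⟪J (v i), v j⟫) • v j)]
    simp [← Finset.sum_smul, ha, hu_def]
  have hnorm : ‖J u‖ = ‖u‖ := by
    rw [norm_eq_sqrt_real_inner, hJi, ← norm_eq_sqrt_real_inner]
  have hpos : 0 < ‖u‖ := norm_pos_iff.mpr hu
  have hle : ‖u‖ ≤ N * (‖u‖ * (1 / ((N : ℝ) + 1))) := by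
    calc ‖u‖ = ‖∑ i, a i • (J (v i) - ∑ j, ⟪J (v i), v j⟫ • v j)‖ := by rw [← hJu, hnorm]
      _ ≤ ∑ _i : Fin (2 * k + 1), ‖u‖ * (1 / ((N : ℝ) + 1)) := by
        refine norm_sum_le_of_le _ fun i _ => ?_
        rw [norm_smul, Real.norm_eq_abs]
        exact mul_le_mul (hcoef i) (hw i).le (norm_nonneg _) hpos.le
      _ = ((2 * k + 1 : ℕ) : ℝ) * (‖u‖ * (1 / ((N : ℝ) + 1))) := by simp
      _ ≤ N * (‖u‖ * (1 / ((N : ℝ) + 1))) := by gcongr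
  have hN1 : (0 : ℝ) < N + 1 := by positivity
  have heq : N * (‖u‖ * (1 / ((N : ℝ) + 1))) = N * ‖u‖ / (N + 1) := by ring
  rw [heq, le_div_iff₀ hN1] at hle
  linarith
end
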